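/- For every positive integer n > 2 there exists a prime number p satisfying 7n < p < 8n. -/

import Mathlib

open ArithmeticFunction (vonMangoldt vonMangoldt_nonneg vonMangoldt_sum)
open Finset Real
open scoped ArithmeticFunction.vonMangoldt Nat

/-- A list of primes in which the intervals `(p / 8, p / 7)` attached to consecutive terms overlap,
so that together they cover every integer in `[3, 1056376)`. -/
def coveringPrimes : List ℕ :=
  [23, 31, 37, 47, 53, 61, 71, 83, 89, 103, 113, 131, 151, 173, 199, 229, 263, 293, 331, 383,
    439, 503, 571, 653, 751, 863, 991, 1129, 1291, 1471, 1669, 1907, 2179, 2477, 2819, 3221,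
    3677, 4201, 4801, 5483, 6271, 7159, 8179, 9349, 10687, 12211, 13933, 15923, 18199, 20789,
    23753, 27143, 31019, 35449, 40519, 46309, 52919, 60457, 69073, 78941, 90217, 103099, 117811,
    134639, 153877, 175859, 200983, 229693, 262511, 300007, 342871, 391847, 447829, 511801,
    584917, 668471, 763967, 873109, 997813, 1140353, 1303261, 1489441, 1702219, 1945399, 2223317,
    2540933, 2903909, 3318719, 3792821, 4334653, 4953877, 5661559, 6470341, 7394627]

/-- If consecutive primes of `l` are close enough, every `n ≥ B` up to the range of the last one
has some `p ∈ l` with `7 * n < p < 8 * n`. -/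
theorem exists_mem_between_of_foldl (l : List ℕ) (B N : ℕ)
    (h : l.foldl (fun b p ↦ b.bind fun b ↦ if p < 8 * b then some ((p - 1) / 7 + 1) else none)
      (some B) = some N) {n : ℕ} (hB : B ≤ n) (hN : n < N) :
    ∃ p ∈ l, 7 * n < p ∧ p < 8 * n := by
  induction l generalizing B with
  | nil => simp at h; omega
  | cons p l ih =>
    simp only [List.foldl_cons, Option.bind_some] at h
    split_ifs at h with hp
    · by_cases hn : n < (p - 1) / 7 + 1
      · exact ⟨p, by simp, by omega, by omega⟩
      · obtain ⟨q, hq, hq'⟩ := ih _ h (by omega)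
        exact ⟨q, by simp [hq], hq'⟩
    · exfalso
      clear ih
      induction l with
      | nil => simp at h
      | cons q l ih => exact ih (by simpa using h)

theorem prime_of_mem_coveringPrimes {p : ℕ} (hp : p ∈ coveringPrimes) : p.Prime := by
  have h : ∀ q ∈ coveringPrimes, q.Prime := by
    norm_num [coveringPrimes]
  exact h p hp

theorem exists_prime_between_of_le {n : ℕ} (hn : 2 < n) (hn' : n ≤ 2 ^ 20) :
    ∃ p : ℕ, p.Prime ∧ 7 * n < p ∧ p < 8 * n := by
  obtain ⟨p, hp, h⟩ := exists_mem_between_of_foldl coveringPrimes 3 1056376 (by decide +kernel)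
    hn (by omega)
  exact ⟨p, prime_of_mem_coveringPrimes hp, h⟩

theorem log_factorial_eq_sum_vonMangoldt {M N : ℕ} (h : M ≤ N) :
    log (M ! : ℝ) = ∑ m ∈ Ioc 0 N, Λ m * ((M / m : ℕ) : ℝ) := by
  induction M with
  | zero => simp
  | succ M ih =>
    have hdiv : ((M + 1).divisors : Finset ℕ) = (Ioc 0 N).filter (· ∣ M + 1) := by
      ext m
      simp only [Nat.mem_divisors, mem_filter, mem_Ioc]
      constructor
      · rintro ⟨hm, -⟩
        exact ⟨⟨Nat.pos_of_dvd_of_pos hm (by omega), (Nat.le_of_dvd (by omega) hm).trans h⟩, hm⟩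
      · rintro ⟨-, hm⟩
        exact ⟨hm, by omega⟩
    rw [Nat.factorial_succ, Nat.cast_mul, log_mul (by positivity) (by positivity),
      ih (by omega), ← vonMangoldt_sum, hdiv, sum_filter, ← sum_add_distrib]
    refine sum_congr rfl fun m _ ↦ ?_
    rw [Nat.succ_div]
    split_ifs <;> push_cast <;> ring

theorem log_factorial_le {n : ℕ} (hn : 1 ≤ n) :
    log (n ! : ℝ) ≤ n * log n - n + 1 + log n := by
  induction n, hn using Nat.le_induction with
  | base => simp
  | succ n hn ih =>
    have hn0 : (0 : ℝ) < n := by exact_mod_cast hn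
    have h : 1 - ((n + 1 : ℝ) / n)⁻¹ ≤ log ((n + 1 : ℝ) / n) :=
      one_sub_inv_le_log_of_pos (by positivity)
    rw [log_div (by positivity) (by positivity)] at h
    have h' : 1 ≤ (n + 1 : ℝ) * (log (n + 1) - log n) := by
      calc (1 : ℝ) = (n + 1) * (1 - ((n + 1 : ℝ) / n)⁻¹) := by field_simp; ring
        _ ≤ _ := by gcongr
    rw [Nat.factorial_succ, Nat.cast_mul, log_mul (by positivity) (by positivity)]
    push_cast
    linarith

theorem mul_log_sub_self_mono {x y : ℝ} (hx : 1 ≤ x) (hxy : x ≤ y) :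
    x * log x - x ≤ y * log y - y := by
  have hx0 : 0 < x := by linarith
  have hy0 : 0 < y := by linarith
  have h : 1 - (y / x)⁻¹ ≤ log (y / x) := one_sub_inv_le_log_of_pos (by positivity)
  rw [log_div (by positivity) (by positivity)] at h
  have h' : y - x ≤ y * (log y - log x) := by
    calc y - x = y * (1 - (y / x)⁻¹) := by
          have : y ≠ 0 := by positivity
          field_simp
      _ ≤ _ := by gcongr
  nlinarith [log_nonneg hx]

/-- A crude form of Stirling's formula, for the factorial of the integer part. -/
theorem abs_log_factorial_div_sub_le {N d : ℕ} (hd : 0 < d) (hN : d ≤ N) :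
    |log ((N / d)! : ℝ) - (N / d * log (N / d) - N / d)| ≤ log N + 1 := by
  have hd' : (1 : ℝ) ≤ d := by exact_mod_cast hd
  have hN' : (d : ℝ) ≤ N := by exact_mod_cast hN
  set x : ℝ := N / d with hx
  have hx1 : 1 ≤ x := by rw [hx, one_le_div (by positivity)]; exact hN'
  have hxN : x ≤ N := div_le_self (by positivity) hd'
  set k := N / d with hk
  have hk1 : 1 ≤ k := Nat.div_pos hN hd
  have hk1' : (1 : ℝ) ≤ k := by exact_mod_cast hk1
  have hkx : (k : ℝ) ≤ x := Nat.cast_div_le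
  have hxk : x ≤ k + 1 := by
    rw [hx, div_le_iff₀ (by positivity)]
    have := Nat.lt_div_mul_add (a := N) hd
    have h2 : N ≤ (k + 1) * d := by rw [hk]; linarith
    exact_mod_cast h2
  have hlog : log x ≤ log N := log_le_log (by positivity) hxN
  have hlogk : log k ≤ log x := log_le_log (by positivity) hkx
  rw [abs_le]
  constructor
  · have h1 := Stirling.le_log_factorial_stirling (n := k) (by omega)
    have h2 : 0 ≤ log (2 * π) := log_nonneg (by linarith [pi_gt_three])
    have h3 : log (x / k) ≤ x / k - 1 := log_le_sub_one_of_pos (by positivity)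
    rw [log_div (by positivity) (by positivity)] at h3
    have h4 : k * (log x - log k) ≤ x - k := by
      calc k * (log x - log k) ≤ k * (x / k - 1) := by gcongr
        _ = x - k := by field_simp
    have h5 : (x - k) * log x ≤ 1 * log x := by
      gcongr
      · exact log_nonneg hx1
      · linarith
    have h6 := log_nonneg hk1'
    linarith
  · have h1 := log_factorial_le hk1
    have h2 := mul_log_sub_self_mono hk1' hkx
    linarith

/-- Weights `(d, c)` for which `∑ c * ⌊v / d⌋` is nonpositive unless `v ≡ 7 [MOD 1680]`. -/
def weights : Finset (ℕ × ℤ) :=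
  {(7, 1), (8, -1), (14, -1), (16, 1), (21, -1), (24, 1), (35, -1), (40, 1), (48, -1), (56, 1),
    (80, -1), (84, 1), (105, 1), (112, -1), (120, -1), (140, 2), (168, -1), (240, 1), (280, -2),
    (336, 1), (840, 2), (1680, 2)}

theorem dvd_of_mem_weights {w : ℕ × ℤ} (hw : w ∈ weights) : w.1 ∣ 1680 := by
  revert w; decide

theorem sum_weights_floor_le (v : ℕ) :
    ∑ w ∈ weights, w.2 * ((v / w.1 : ℕ) : ℤ) ≤
      (if v = 7 then 1 else 0) + if 1680 ≤ v then 1 else 0 := by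
  have h0 : ∑ w ∈ weights, w.2 * ((1680 / w.1 : ℕ) : ℤ) = 0 := by decide +kernel
  have hper : ∑ w ∈ weights, w.2 * ((v / w.1 : ℕ) : ℤ) =
      ∑ w ∈ weights, w.2 * ((v % 1680 / w.1 : ℕ) : ℤ) := by
    rw [← sub_eq_zero, ← sum_sub_distrib, ← mul_zero ((v / 1680 : ℕ) : ℤ), ← h0, mul_sum]
    refine sum_congr rfl fun w hw ↦ ?_
    obtain ⟨k, hk⟩ := dvd_of_mem_weights hw
    have hw0 : 0 < w.1 := Nat.pos_of_dvd_of_pos ⟨k, hk⟩ (by norm_num)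
    have h1 : v / w.1 = v % 1680 / w.1 + k * (v / 1680) := by
      conv_lhs => rw [← Nat.mod_add_div v 1680]
      nth_rw 2 [hk]
      rw [mul_assoc, Nat.add_mul_div_left _ _ hw0]
    have h2 : 1680 / w.1 = k := by rw [hk]; exact Nat.mul_div_cancel_left k hw0
    rw [h1, h2]
    push_cast
    ring
  have hfin : ∀ r < 1680, ∑ w ∈ weights, w.2 * ((r / w.1 : ℕ) : ℤ) ≤ if r = 7 then 1 else 0 := by
    decide +kernel
  rw [hper]
  refine (hfin _ (Nat.mod_lt v (by norm_num))).trans ?_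
  split_ifs <;> omega

theorem sum_weights_log_factorial_le {n : ℕ}
    (h : ∀ p : ℕ, p.Prime → 7 * n < p → 8 * n ≤ p) :
    ∑ w ∈ weights, (w.2 : ℝ) * log ((56 * n / w.1)! : ℝ) ≤
      (Chebyshev.psi (8 * n) - Chebyshev.theta (8 * n)) + Chebyshev.psi (n / 30) := by
  have hfl : ⌊(8 * n : ℝ)⌋₊ = 8 * n := by exact_mod_cast Nat.floor_natCast (8 * n)
  have hfl' : ⌊(n / 30 : ℝ)⌋₊ = n / 30 := by exact_mod_cast Nat.floor_div_eq_div n 30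
  calc ∑ w ∈ weights, (w.2 : ℝ) * log ((56 * n / w.1)! : ℝ)
      = ∑ m ∈ Ioc 0 (56 * n), Λ m *
          ((∑ w ∈ weights, w.2 * ((56 * n / m / w.1 : ℕ) : ℤ) : ℤ) : ℝ) := by
        simp_rw [log_factorial_eq_sum_vonMangoldt (Nat.div_le_self (56 * n) _), mul_sum]
        rw [sum_comm]
        refine sum_congr rfl fun m _ ↦ ?_
        simp only [Int.cast_sum, Int.cast_mul, Int.cast_natCast, mul_sum]
        refine sum_congr rfl fun w _ ↦ ?_
        rw [Nat.div_div_eq_div_mul, Nat.div_div_eq_div_mul, mul_comm m]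
        ring
    _ ≤ ∑ m ∈ Ioc 0 (56 * n), Λ m *
          (((if 56 * n / m = 7 then 1 else 0) + if 1680 ≤ 56 * n / m then 1 else 0 : ℤ) : ℝ) := by
        exact sum_le_sum fun m _ ↦ mul_le_mul_of_nonneg_left
          (Int.cast_le.2 (sum_weights_floor_le _)) vonMangoldt_nonneg
    _ = ∑ m ∈ Ioc 0 (56 * n) with 56 * n / m = 7, Λ m +
          ∑ m ∈ Ioc 0 (56 * n) with 1680 ≤ 56 * n / m, Λ m := by
        rw [sum_filter, sum_filter, ← sum_add_distrib]
        refine sum_congr rfl fun m _ ↦ ?_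
        split_ifs <;> simp [← two_mul, mul_comm]
    _ ≤ _ := by
        rw [Chebyshev.psi_sub_theta_eq_sum_not_prime, Chebyshev.psi, hfl, hfl']
        gcongr ?_ + ?_
        · refine sum_le_sum_of_subset_of_nonneg ?_ fun _ _ _ ↦ vonMangoldt_nonneg
          intro m
          simp only [mem_filter, mem_Ioc]
          rintro ⟨⟨hm, -⟩, h7⟩
          rw [Nat.div_eq_iff hm] at h7
          refine ⟨⟨hm, by omega⟩, fun hp ↦ ?_⟩
          have h8 : m = 8 * n := le_antisymm (by omega) (h m hp (by omega))
          have h2 := (Nat.prime_dvd_prime_iff_eq Nat.prime_two hp).1 (by omega)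
          omega
        · refine sum_le_sum_of_subset_of_nonneg ?_ fun _ _ _ ↦ vonMangoldt_nonneg
          intro m
          simp only [mem_filter, mem_Ioc]
          rintro ⟨⟨hm, -⟩, h7⟩
          rw [Nat.le_div_iff_mul_le hm] at h7
          exact ⟨hm, by omega⟩

theorem log_seven_lt : log 7 < 1.947 := by
  have h : 5 * log 7 ≤ 3 * log 3 + 4 * log 5 := by
    have : log (7 ^ 5 : ℝ) ≤ log (3 ^ 3 * 5 ^ 4) := log_le_log (by norm_num) (by norm_num)
    rw [log_mul (by norm_num) (by norm_num), log_pow, log_pow, log_pow] at this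
    exact_mod_cast this
  linarith [log_three_lt_d9, log_five_lt_d9]

theorem sum_weights_main_term {x : ℝ} (hx : 0 < x) :
    ∑ w ∈ weights, (w.2 : ℝ) * (x / w.1 * log (x / w.1) - x / w.1) =
      x * (1 / 12 * log 2 + 1 / 112 * log 3 - 1 / 30 * log 7) := by
  have hL (a b c d : ℕ) : log (2 ^ a * 3 ^ b * 5 ^ c * 7 ^ d : ℝ) =
      a * log 2 + b * log 3 + c * log 5 + d * log 7 := by
    rw [log_mul (by positivity) (by positivity), log_mul (by positivity) (by positivity),
      log_mul (by positivity) (by positivity), log_pow, log_pow, log_pow, log_pow]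
  have h8 : log 8 = _ := .trans (by norm_num) (hL 3 0 0 0)
  have h14 : log 14 = _ := .trans (by norm_num) (hL 1 0 0 1)
  have h16 : log 16 = _ := .trans (by norm_num) (hL 4 0 0 0)
  have h21 : log 21 = _ := .trans (by norm_num) (hL 0 1 0 1)
  have h24 : log 24 = _ := .trans (by norm_num) (hL 3 1 0 0)
  have h35 : log 35 = _ := .trans (by norm_num) (hL 0 0 1 1)
  have h40 : log 40 = _ := .trans (by norm_num) (hL 3 0 1 0)
  have h48 : log 48 = _ := .trans (by norm_num) (hL 4 1 0 0)
  have h56 : log 56 = _ := .trans (by norm_num) (hL 3 0 0 1)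
  have h80 : log 80 = _ := .trans (by norm_num) (hL 4 0 1 0)
  have h84 : log 84 = _ := .trans (by norm_num) (hL 2 1 0 1)
  have h105 : log 105 = _ := .trans (by norm_num) (hL 0 1 1 1)
  have h112 : log 112 = _ := .trans (by norm_num) (hL 4 0 0 1)
  have h120 : log 120 = _ := .trans (by norm_num) (hL 3 1 1 0)
  have h140 : log 140 = _ := .trans (by norm_num) (hL 2 0 1 1)
  have h168 : log 168 = _ := .trans (by norm_num) (hL 3 1 0 1)
  have h240 : log 240 = _ := .trans (by norm_num) (hL 4 1 1 0)
  have h280 : log 280 = _ := .trans (by norm_num) (hL 3 0 1 1)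
  have h336 : log 336 = _ := .trans (by norm_num) (hL 4 1 0 1)
  have h840 : log 840 = _ := .trans (by norm_num) (hL 3 1 1 1)
  have h1680 : log 1680 = _ := .trans (by norm_num) (hL 4 1 1 1)
  have hdiv (d : ℕ) (hd : 0 < d) : log (x / d) = log x - log d :=
    log_div hx.ne' (by positivity)
  have hpos (w : ℕ × ℤ) (hw : w ∈ weights) : 0 < w.1 :=
    Nat.pos_of_dvd_of_pos (dvd_of_mem_weights hw) (by norm_num)
  rw [sum_congr rfl fun w hw ↦ by rw [hdiv w.1 (hpos w hw)]]
  simp only [weights]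
  repeat rw [sum_insert (by decide)]
  rw [sum_singleton]
  push_cast
  rw [h8, h14, h16, h21, h24, h35, h40, h48, h56, h80, h84, h105, h112, h120, h140, h168, h240,
    h280, h336, h840, h1680]
  push_cast
  ring

theorem le_sum_weights_log_factorial {n : ℕ} (hn : 30 ≤ n) :
    0.149 * n - 26 * (log (56 * n) + 1) ≤
      ∑ w ∈ weights, (w.2 : ℝ) * log ((56 * n / w.1)! : ℝ) := by
  have hn0 : (0 : ℝ) < n := by exact_mod_cast (by omega : 0 < n)
  have h26 : ∑ w ∈ weights, |(w.2 : ℝ)| = 26 := by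
    have : ∑ w ∈ weights, |w.2| = 26 := by decide +kernel
    exact_mod_cast this
  have hmain := sum_weights_main_term (x := 56 * n) (by positivity)
  have hlog : (0.149 : ℝ) ≤ 56 * (1 / 12 * log 2 + 1 / 112 * log 3 - 1 / 30 * log 7) := by
    linarith [log_two_gt_d9, log_three_gt_d9, log_seven_lt]
  have herr : ∑ w ∈ weights, (w.2 : ℝ) *
        (56 * n / w.1 * log (56 * n / w.1) - 56 * n / w.1) -
      ∑ w ∈ weights, (w.2 : ℝ) * log ((56 * n / w.1)! : ℝ) ≤ 26 * (log (56 * n) + 1) := by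
    rw [← h26, ← sum_sub_distrib, sum_mul]
    refine sum_le_sum fun w hw ↦ ?_
    have hd := dvd_of_mem_weights hw
    have hd0 := Nat.pos_of_dvd_of_pos hd (by norm_num)
    have hdn : w.1 ≤ 56 * n := (Nat.le_of_dvd (by norm_num) hd).trans (by omega)
    have := abs_log_factorial_div_sub_le hd0 hdn
    push_cast at this
    rw [← mul_sub]
    refine (le_abs_self _).trans ?_
    rw [abs_mul, abs_sub_comm]
    gcongr
  nlinarith

theorem exists_prime_between_of_ge {n : ℕ} (hn : 2 ^ 20 ≤ n) :
    ∃ p : ℕ, p.Prime ∧ 7 * n < p ∧ p < 8 * n := by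
  by_contra! hcon
  have hlower := le_sum_weights_log_factorial (n := n) (by omega)
  have hupper := sum_weights_log_factorial_le hcon
  have hnR : (2 ^ 20 : ℝ) ≤ n := by exact_mod_cast hn
  have hpp := Chebyshev.psi_sub_theta_le (x := 8 * n) (by linarith)
  have htail := Chebyshev.psi_le (x := n / 30) (by linarith)
  obtain ⟨s, hs, hsn⟩ : ∃ s : ℝ, 1024 ≤ s ∧ (n : ℝ) = s ^ 2 :=
    ⟨√n, Real.le_sqrt_of_sq_le (by linarith), (Real.sq_sqrt (by linarith)).symm⟩
  have hs0 : 0 < s := by linarith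
  have hlog2 := log_two_lt_d9
  have hlog2' := log_two_gt_d9
  have hlogs : log s ≤ 10 * log 2 + s / 1024 - 1 := by
    have h := log_le_sub_one_of_pos (x := s / 1024) (by positivity)
    rw [log_div (by positivity) (by norm_num), show (1024 : ℝ) = 2 ^ 10 by norm_num, log_pow] at h
    norm_num at h ⊢
    linarith
  have hlogs0 : 0 ≤ log s := log_nonneg (by linarith)
  have hl8 : log 8 = 3 * log 2 := by
    rw [show (8 : ℝ) = 2 ^ 3 by norm_num, log_pow]; norm_num
  have hl4 : log 4 = 2 * log 2 := by
    rw [show (4 : ℝ) = 2 ^ 2 by norm_num, log_pow]; norm_num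
  have hl56 : log (56 * s ^ 2) = 3 * log 2 + log 7 + 2 * log s := by
    rw [show (56 : ℝ) = 8 * 7 by norm_num, log_mul (by norm_num) (by positivity),
      log_mul (by norm_num) (by norm_num), log_pow, hl8]
    norm_num
  have hl8s : log (8 * s ^ 2) = 3 * log 2 + 2 * log s := by
    rw [log_mul (by norm_num) (by positivity), log_pow, hl8]
    norm_num
  have hl30 : log (s ^ 2 / 30) ≤ 2 * log s - 4 * log 2 := by
    have : log (s ^ 2 / 30) ≤ log (s ^ 2 / 2 ^ 4) := by
      apply log_le_log (by positivity); gcongr; norm_num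
    rw [log_div (x := s ^ 2) (y := 2 ^ 4) (by positivity) (by positivity), log_pow,
      log_pow] at this
    exact_mod_cast this
  have hr8 : √(8 * s ^ 2) ≤ 2.83 * s := by
    rw [Real.sqrt_le_left (by positivity)]; nlinarith
  have hr30 : √(s ^ 2 / 30) ≤ 0.183 * s := by
    rw [Real.sqrt_le_left (by positivity)]; nlinarith
  rw [hsn] at hlower hupper hpp htail
  have hpp' : 2 * √(8 * s ^ 2) * log (8 * s ^ 2) ≤
      2 * (2.83 * s) * (13.95 + s / 512) := by
    have : log (8 * s ^ 2) ≤ 13.95 + s / 512 := by rw [hl8s]; linarith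
    have : 0 ≤ log (8 * s ^ 2) := log_nonneg (by nlinarith)
    gcongr
  have htail' : 2 * √(s ^ 2 / 30) * log (s ^ 2 / 30) ≤ 2 * (0.183 * s) * (9.1 + s / 512) := by
    have : log (s ^ 2 / 30) ≤ 9.1 + s / 512 := by linarith
    have : 0 ≤ log (s ^ 2 / 30) := log_nonneg (by nlinarith)
    gcongr
  rw [hl56] at hlower
  rw [hl4] at htail
  have hseven := log_seven_lt
  have htail'' : 2 * log 2 * (s ^ 2 / 30) ≤ 1.3863 * (s ^ 2 / 30) := by
    gcongr; linarith
  nlinarith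

theorem stmt_6 (n : ℕ) (hn : 2 < n) : ∃ p : ℕ, p.Prime ∧ 7 * n < p ∧ p < 8 * n := by
  rcases le_total n (2 ^ 20) with h | h
  · exact exists_prime_between_of_le hn h
  · exact exists_prime_between_of_ge h
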